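/- arXiv:2312.03362 — 2 statements merged into one kernel-verified Lean document; each statement's English description precedes it below -/
import Mathlib

section
/- Let ξ be a height function on [1,n], let r ≥ 1, and let 1 ≤ i < j ≤ n. If i_⋄ < j − 1 and j − 1 = (j−1)_⋄, then in 𝒫: (ω(i,j))_r = (ω(i, (j−1)_•+1))_r · (Y_{j, ξ(j)+ε})_r, where ε := ξ(j) − ξ(j−1) ∈ {1, −1}. -/
open scoped Classical

/-- A height function on `[1,n]`. -/
def HeightFunction (n : ℤ) (ξ : ℤ → ℤ) : Prop :=
  (∀ i : ℤ, 2 ≤ i → i ≤ n → |ξ i - ξ (i - 1)| = 1) ∧ ξ 0 = ξ 2 ∧ ξ (n + 1) = ξ (n - 1)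

/-- `i_⋄`: the minimal `l ∈ [i, n−2]` with `ξ(l) = ξ(l+2)`, and `n−1` if no such `l` exists;
by convention `n_⋄ = n` (the case `i = n−1` is covered by the empty-set default `n−1`). -/
noncomputable def diamond (n : ℤ) (ξ : ℤ → ℤ) (i : ℤ) : ℤ :=
  if i = n then n
  else if ({l : ℤ | i ≤ l ∧ l ≤ n - 2 ∧ ξ l = ξ (l + 2)} : Set ℤ).Nonempty then
    sInf {l : ℤ | i ≤ l ∧ l ≤ n - 2 ∧ ξ l = ξ (l + 2)}
  else n - 1

/-- `j_•`: `0` for `j ≤ 1_⋄`, and otherwise the maximal `l ∈ [1_⋄, j)` with `l = l_⋄`. -/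
noncomputable def bullet (n : ℤ) (ξ : ℤ → ℤ) (j : ℤ) : ℤ :=
  if j ≤ diamond n ξ 1 then 0
  else sSup {l : ℤ | diamond n ξ 1 ≤ l ∧ l < j ∧ l = diamond n ξ l}

/-- The free abelian group `𝒫` on the symbols `Y_{i,a}`, written multiplicatively. -/
abbrev P : Type := Multiplicative ((ℤ × ℤ) →₀ ℤ)

/-- The generator `Y_{i,a}` of `𝒫`. -/
noncomputable def Y (i a : ℤ) : P := Multiplicative.ofAdd (Finsupp.single (i, a) 1)

/-- `(Y_{i,a})_r := ∏_{t=0}^{r-1} Y_{i, a+2t}`. -/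
noncomputable def Ypow (i a : ℤ) (r : ℕ) : P := ∏ t ∈ Finset.range r, Y i (a + 2 * (t : ℤ))

/-- `(ω(i,j))_r`, where `ω(i,j) = Y_{i₁,a₁} ⋯ Y_{i_k,a_k}` with `i = i₁ < i₂ < ⋯ < i_k = j`,
the middle indices being the `l` with `i < l < j` and `ξ(l−1) = ξ(l+1)`, and
`a₁ = 2ξ(i) − ξ(i+1)`, `a_l = 2ξ(i_l) − ξ(i_l − 1)` for `l ≥ 2`. -/
noncomputable def omegaR (ξ : ℤ → ℤ) (i j : ℤ) (r : ℕ) : P :=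
  Ypow i (2 * ξ i - ξ (i + 1)) r *
    (∏ l ∈ (Finset.Ioo i j).filter (fun l => ξ (l - 1) = ξ (l + 1)),
      Ypow l (2 * ξ l - ξ (l - 1)) r) *
    Ypow j (2 * ξ j - ξ (j - 1)) r


theorem diamond_spec_aux (n : ℤ) (ξ : ℤ → ℤ) (i : ℤ) (h : diamond n ξ i < n - 1) :
    i ≤ diamond n ξ i ∧ ξ (diamond n ξ i) = ξ (diamond n ξ i + 2) := by
  unfold diamond at h ⊢
  split_ifs at h ⊢ with h1 h2
  · omega
  · have hb : BddBelow {l : ℤ | i ≤ l ∧ l ≤ n - 2 ∧ ξ l = ξ (l + 2)} := ⟨i, fun x hx => hx.1⟩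
    have hm := Int.csInf_mem h2 hb
    exact ⟨hm.1, hm.2.2⟩
  · omega

theorem diamond_le_aux (n : ℤ) (ξ : ℤ → ℤ) (i l : ℤ) (h : i ≤ l) (hl : l ≤ n - 2)
    (hx : ξ l = ξ (l + 2)) : diamond n ξ i ≤ l := by
  unfold diamond
  have h2 : ({l : ℤ | i ≤ l ∧ l ≤ n - 2 ∧ ξ l = ξ (l + 2)} : Set ℤ).Nonempty := ⟨l, h, hl, hx⟩
  have hb : BddBelow {l : ℤ | i ≤ l ∧ l ≤ n - 2 ∧ ξ l = ξ (l + 2)} := ⟨i, fun x hx => hx.1⟩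
  rw [if_neg (by omega), if_pos h2]
  exact csInf_le hb ⟨h, hl, hx⟩

theorem diamond_eq_aux (n : ℤ) (ξ : ℤ → ℤ) (l : ℤ) (hl : l ≤ n - 2)
    (hx : ξ l = ξ (l + 2)) : l = diamond n ξ l := by
  have h := diamond_le_aux n ξ l l le_rfl hl hx
  have := (diamond_spec_aux n ξ l (by omega)).1
  omega

/-- If `i_⋄ < j − 1` and `j − 1 = (j−1)_⋄`, then
`(ω(i,j))_r = (ω(i, (j−1)_•+1))_r ⬝ (Y_{j, ξ(j)+ε})_r`, where `ε = ξ(j) − ξ(j−1) ∈ {1,−1}`. -/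
theorem omegaR_factor_of_eq_diamond (n : ℤ) (hn : 2 ≤ n) (ξ : ℤ → ℤ)
    (hξ : HeightFunction n ξ) (r : ℕ) (hr : 1 ≤ r) (i j : ℤ)
    (h1 : 1 ≤ i) (hij : i < j) (hj : j ≤ n)
    (hd : diamond n ξ i < j - 1) (hnd : j - 1 = diamond n ξ (j - 1)) :
    omegaR ξ i j r =
      omegaR ξ i (bullet n ξ (j - 1) + 1) r * Ypow j (ξ j + (ξ j - ξ (j - 1))) r := by
  obtain ⟨d1, d2⟩ := diamond_spec_aux n ξ i (by omega)
  have d3 := diamond_le_aux n ξ 1 _ (by omega) (by omega) d2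
  have hS : bullet n ξ (j - 1) =
      sSup {l : ℤ | diamond n ξ 1 ≤ l ∧ l < j - 1 ∧ l = diamond n ξ l} := by
    unfold bullet
    rw [if_neg (by omega)]
  have hb : BddAbove {l : ℤ | diamond n ξ 1 ≤ l ∧ l < j - 1 ∧ l = diamond n ξ l} :=
    ⟨j, fun x hx => by have := hx.2.1; omega⟩
  have hdm : diamond n ξ i ∈ {l : ℤ | diamond n ξ 1 ≤ l ∧ l < j - 1 ∧ l = diamond n ξ l} :=
    ⟨d3, hd, diamond_eq_aux n ξ _ (by omega) d2⟩
  have hm := Int.csSup_mem ⟨_, hdm⟩ hb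
  have hge : ∀ l, diamond n ξ 1 ≤ l → l < j - 1 → ξ l = ξ (l + 2) → l ≤ bullet n ξ (j - 1) := by
    intro l a1 a2 a3
    rw [hS]
    exact le_csSup hb ⟨a1, a2, diamond_eq_aux n ξ _ (by omega) a3⟩
  have hdb := hge _ d3 hd d2
  rw [← hS] at hm
  obtain ⟨m1, m2, m3⟩ := hm
  generalize bullet n ξ (j - 1) = b at *
  have hb2 : ξ b = ξ (b + 2) := by
    have := (diamond_spec_aux n ξ b (by omega)).2
    rwa [← m3] at this
  have hset : (Finset.Ioo i j).filter (fun l => ξ (l - 1) = ξ (l + 1)) =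
      insert (b + 1) ((Finset.Ioo i (b + 1)).filter (fun l => ξ (l - 1) = ξ (l + 1))) := by
    ext l
    simp only [Finset.mem_filter, Finset.mem_Ioo, Finset.mem_insert]
    constructor
    · rintro ⟨⟨l1, l2⟩, l3⟩
      by_cases hl : l = b + 1
      · exact Or.inl hl
      · refine Or.inr ⟨⟨l1, ?_⟩, l3⟩
        by_contra hc
        have := hge (l - 1) (by omega) (by omega)
          (by rw [l3]; congr 1; ring)
        omega
    · rintro (rfl | ⟨⟨l1, l2⟩, l3⟩)
      · refine ⟨⟨by omega, by omega⟩, ?_⟩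
        rw [show b + 1 - 1 = b by ring, show b + 1 + 1 = b + 2 by ring, hb2]
      · exact ⟨⟨l1, by omega⟩, l3⟩
  unfold omegaR
  rw [hset, Finset.prod_insert (by simp),
    show ξ j + (ξ j - ξ (j - 1)) = 2 * ξ j - ξ (j - 1) by ring]
  simp only [mul_assoc, mul_comm, mul_left_comm]
end

section
/- Let ξ be a height function on [1,n] and let 1 ≤ i < j + 1 ≤ n with j_⋄ = j and (j+1)_⋄ = j+1. Then in the field F the following exchange identities hold: (1) if j_• = i_•, then x[α_{i,j+1}] = x[α_{i,j}] · x[α_{j+1,j+1}] − x_{i−1} · x_{j+2}; (2) if j_• = i, then x[α_{i,j+1}] = x[α_{i,j}] · x[α_{j+1,j+1}] − f′_i f″_i · x_{j+2}; (3) if j_• > i and j_•−1 = (j_•−1)_⋄, then x[α_{i,j+1}] = x[α_{i,j}] · x[α_{j+1,j+1}] − x[α_{i, j_•−1}] · f′_{j_•} f″_{j_•} · x_{j+2}; (4) if j_• > i and j_•−1 ≠ (j_•−1)_⋄, then x[α_{i,j+1}] = x[α_{i,j}] · x[α_{j+1,j+1}] − x[α_{i, j_•−1}] · x_{j+2}.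 -/
open scoped Classical

/-- `d_j`: `1` if `j = j_⋄` and `0` otherwise (with the convention `d_l = 0` for `l ≤ 0`). -/
noncomputable def dd (n : ℤ) (ξ : ℤ → ℤ) (j : ℤ) : ℤ :=
  if 1 ≤ j ∧ j = diamond n ξ j then 1 else 0

/-- Vertices of the iced quiver `Q_ξ`: `pr i = i′` (frozen), `mut i = i` (mutable for
`1 ≤ i ≤ n`), `dpr i = i″` (frozen). -/
inductive V : Type
  | pr : ℤ → V
  | mut : ℤ → V
  | dpr : ℤ → V
  deriving DecidableEq

/-- The number of arrows `u → v` in the iced quiver `Q_ξ`. -/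
noncomputable def arrows (n : ℤ) (ξ : ℤ → ℤ) : V → V → ℤ
  | V.mut j, V.mut k =>
      if k = j + 1 ∧ 1 ≤ j ∧ j ≤ n - 1 ∧
          ((ξ (j + 1) = ξ j + 1 ∧ dd n ξ j = 1) ∨ (ξ (j + 1) = ξ j - 1 ∧ dd n ξ j = 0)) then 1
      else if j = k + 1 ∧ 1 ≤ k ∧ k ≤ n - 1 ∧
          ((ξ (k + 1) = ξ k + 1 ∧ dd n ξ k = 0) ∨ (ξ (k + 1) = ξ k - 1 ∧ dd n ξ k = 1)) then 1
      else 0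
  | V.pr i, V.mut j =>
      if (i = j ∧ ((1 ≤ j ∧ j ≤ n - 1 ∧ ξ (j + 1) = ξ j + 1) ∨ (j = n ∧ ξ (n - 1) = ξ n + 1)))
          ∨ (i = j + 1 ∧ 1 ≤ j ∧ j ≤ n - 1 ∧ ξ (j + 1) = ξ j - 1 ∧ dd n ξ j = 0) then 1
      else 0
  | V.mut j, V.pr i =>
      if (i = j ∧ ((1 ≤ j ∧ j ≤ n - 1 ∧ ξ (j + 1) = ξ j - 1) ∨ (j = n ∧ ξ (n - 1) = ξ n - 1)))
          ∨ (i = j + 1 ∧ 1 ≤ j ∧ j ≤ n - 1 ∧ ξ (j + 1) = ξ j + 1 ∧ dd n ξ j = 0) then 1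
      else 0
  | V.dpr i, V.mut j =>
      if (i = j ∧ ((1 ≤ j ∧ j ≤ n - 1 ∧ ξ (j + 1) = ξ j + 1) ∨ (j = n ∧ ξ (n - 1) = ξ n + 1)))
          ∨ (i = j + 1 ∧ 1 ≤ j ∧ j ≤ n - 1 ∧ ξ (j + 1) = ξ j - 1 ∧ dd n ξ j = 0) then 1
      else 0
  | V.mut j, V.dpr i =>
      if (i = j ∧ ((1 ≤ j ∧ j ≤ n - 1 ∧ ξ (j + 1) = ξ j - 1) ∨ (j = n ∧ ξ (n - 1) = ξ n - 1)))
          ∨ (i = j + 1 ∧ 1 ≤ j ∧ j ≤ n - 1 ∧ ξ (j + 1) = ξ j + 1 ∧ dd n ξ j = 0) then 1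
      else 0
  | _, _ => 0

/-- The skew-symmetric matrix `B_ξ` encoding `Q_ξ`:
`B_ξ(u,v) = (arrows u → v) − (arrows v → u)`. -/
noncomputable def Bxi (n : ℤ) (ξ : ℤ → ℤ) (u v : V) : ℤ := arrows n ξ u v - arrows n ξ v u

/-- Frozen vertices of `Q_ξ`. -/
def V.frozen : V → Bool
  | V.mut _ => false
  | _ => true

/-- Matrix mutation at the vertex `k`: `μ_k(B)(u,v) = −B(u,v)` if `u = k` or `v = k`, and
`B(u,v) + (|B(u,k)| B(k,v) + B(u,k) |B(k,v)|)/2` otherwise, with every entry between two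
frozen vertices set to `0`. -/
noncomputable def mutateB (k : V) (B : V → V → ℤ) : V → V → ℤ := fun u v =>
  if u.frozen ∧ v.frozen then 0
  else if u = k ∨ v = k then -B u v
  else B u v + (|B u k| * B k v + B u k * |B k v|) / 2

/-- The ambient field: the fraction field of the polynomial ring over `ℚ` whose
indeterminates are indexed by the vertices of `Q_ξ`; the `3n` indeterminates attached to
the vertices `1′,…,n′,1,…,n,1″,…,n″` generate the field `F` of the paper. -/
abbrev F : Type := FractionRing (MvPolynomial V ℚ)

/-- The indeterminate attached to a vertex. -/
noncomputable def gen (v : V) : F := algebraMap (MvPolynomial V ℚ) F (MvPolynomial.X v)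

/-- The initial extended cluster: the indeterminate at each vertex with label in `[1,n]`,
and `1` otherwise (the conventions `x_0 = x_{n+1} = f′_{n+1} = f″_{n+1} = 1`). -/
noncomputable def initZ (n : ℤ) : V → F
  | V.pr l => if 1 ≤ l ∧ l ≤ n then gen (V.pr l) else 1
  | V.mut l => if 1 ≤ l ∧ l ≤ n then gen (V.mut l) else 1
  | V.dpr l => if 1 ≤ l ∧ l ≤ n then gen (V.dpr l) else 1

/-- Seed mutation at the vertex `k`: the exchange relation
`z_k ↦ (∏_{B(u,k)>0} z_u^{B(u,k)} + ∏_{B(u,k)<0} z_u^{−B(u,k)})/z_k` together with matrix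
mutation. -/
noncomputable def mutateSeed (k : V) (S : (V → F) × (V → V → ℤ)) : (V → F) × (V → V → ℤ) :=
  ⟨fun v =>
    if v = k then
      ((finprod fun u => S.1 u ^ (S.2 u k).toNat) +
        (finprod fun u => S.1 u ^ (-(S.2 u k)).toNat)) / S.1 k
    else S.1 v,
   mutateB k S.2⟩

/-- The seed obtained from the initial seed `(initZ n, B_ξ)` by mutating successively at
the mutable vertices `i, i+1, …, i+m−1`. -/
noncomputable def seedFrom (n : ℤ) (ξ : ℤ → ℤ) (i : ℤ) (m : ℕ) : (V → F) × (V → V → ℤ) :=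
  ((List.range m).map fun t => i + (t : ℤ)).foldl (fun S k => mutateSeed (V.mut k) S)
    ⟨initZ n, Bxi n ξ⟩

/-- The cluster variable `x[α_{i,j}]`: the element attached to the vertex `j` after
mutating successively at `i, i+1, …, j`. -/
noncomputable def xAlpha (n : ℤ) (ξ : ℤ → ℤ) (i j : ℤ) : F :=
  (seedFrom n ξ i (j + 1 - i).toNat).1 (V.mut j)

/-- `x_l` (with `x_0 = x_{n+1} = 1`). -/
noncomputable def xv (n : ℤ) (l : ℤ) : F := initZ n (V.mut l)

/-- `f′_l` (with `f′_{n+1} = 1`). -/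
noncomputable def fp (n : ℤ) (l : ℤ) : F := initZ n (V.pr l)

/-- `f″_l` (with `f″_{n+1} = 1`). -/
noncomputable def fpp (n : ℤ) (l : ℤ) : F := initZ n (V.dpr l)

/-- The Kronecker delta. -/
def kron (a b : ℤ) : ℤ := if a = b then 1 else 0

lemma diamond_eq_iff (n : ℤ) (ξ : ℤ → ℤ) (k : ℤ) (hk : k ≤ n - 2) :
    diamond n ξ k = k ↔ ξ k = ξ (k + 2) := by
  unfold diamond
  rw [if_neg (by omega)]
  constructor
  · intro h
    split_ifs at h with hne
    · have := Int.csInf_mem hne ⟨k, fun l hl => hl.1⟩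
      rw [h] at this
      exact this.2.2
    · omega
  · intro h
    have hm : k ∈ {l : ℤ | k ≤ l ∧ l ≤ n - 2 ∧ ξ l = ξ (l + 2)} := ⟨le_refl _, hk, h⟩
    rw [if_pos ⟨k, hm⟩]
    exact IsLeast.csInf_eq ⟨hm, fun l hl => hl.1⟩

lemma diamond_pred (n : ℤ) (ξ : ℤ → ℤ) : diamond n ξ (n - 1) = n - 1 := by
  unfold diamond
  rw [if_neg (by omega), if_neg]
  rintro ⟨l, hl⟩
  simp only [Set.mem_setOf_eq] at hl
  omega

lemma diamond_self (n : ℤ) (ξ : ℤ → ℤ) : diamond n ξ n = n := by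
  unfold diamond
  simp

lemma le_diamond (n : ℤ) (ξ : ℤ → ℤ) (k : ℤ) (hk : k ≤ n) : k ≤ diamond n ξ k := by
  unfold diamond
  split_ifs with h hne
  · omega
  · have := Int.csInf_mem hne ⟨k, fun l hl => hl.1⟩
    exact this.1
  · omega

lemma diamond_le (n : ℤ) (ξ : ℤ → ℤ) (k l : ℤ) (hk : k ≤ l) (hl : l ≤ n)
    (h : diamond n ξ l = l) : diamond n ξ k ≤ l := by
  by_cases hkl : k = l
  · subst hkl; omega
  unfold diamond
  rw [if_neg (by omega)]
  split_ifs with hne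
  · by_cases h2 : l ≤ n - 2
    · apply csInf_le ⟨k, fun l hl => hl.1⟩
      exact ⟨hk, h2, (diamond_eq_iff n ξ l h2).1 h⟩
    · have := Int.csInf_mem hne ⟨k, fun l hl => hl.1⟩
      have := this.2.1
      omega
  · by_cases h2 : l ≤ n - 2
    · exact absurd ⟨l, hk, h2, (diamond_eq_iff n ξ l h2).1 h⟩ hne
    · omega

lemma dd_01 (n : ℤ) (ξ : ℤ → ℤ) (k : ℤ) : dd n ξ k = 0 ∨ dd n ξ k = 1 := by
  unfold dd; split_ifs <;> simp

lemma dd_one_iff (n : ℤ) (ξ : ℤ → ℤ) (k : ℤ) (hk : 1 ≤ k) :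
    dd n ξ k = 1 ↔ diamond n ξ k = k := by
  unfold dd
  split_ifs with h
  · simp [h.2.symm]
  · simp only [zero_ne_one, false_iff]
    intro h'
    exact h ⟨hk, h'.symm⟩

lemma dd_n (n : ℤ) (ξ : ℤ → ℤ) (hn : 2 ≤ n) : dd n ξ n = 1 := by
  rw [dd_one_iff n ξ n (by omega)]; exact diamond_self n ξ

/-- slope -/
def sl (ξ : ℤ → ℤ) (k : ℤ) : ℤ := ξ (k + 1) - ξ k

lemma sl_pm (n : ℤ) (hn : 2 ≤ n) (ξ : ℤ → ℤ) (hξ : HeightFunction n ξ) (k : ℤ) (h1 : 1 ≤ k)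
    (h2 : k ≤ n) : sl ξ k = 1 ∨ sl ξ k = -1 := by
  unfold sl
  obtain ⟨h, -, hb⟩ := hξ
  by_cases hk : k = n
  · subst hk
    have := h k (by omega) le_rfl
    rcases (abs_eq (by norm_num)).1 this with h' | h' <;> omega
  · have := h (k + 1) (by omega) (by omega)
    rw [show k + 1 - 1 = k by ring] at this
    exact (abs_eq (by norm_num)).1 this

lemma sl_succ (n : ℤ) (hn : 2 ≤ n) (ξ : ℤ → ℤ) (hξ : HeightFunction n ξ) (k : ℤ) (h1 : 1 ≤ k)
    (h2 : k + 1 ≤ n) : sl ξ (k + 1) = sl ξ k * (1 - 2 * dd n ξ k) := by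
  have a := sl_pm n hn ξ hξ k h1 (by omega)
  have b := sl_pm n hn ξ hξ (k + 1) (by omega) h2
  have hd := dd_01 n ξ k
  have hi := dd_one_iff n ξ k h1
  have key : diamond n ξ k = k ↔ ξ k = ξ (k + 2) := by
    by_cases hk : k ≤ n - 2
    · exact diamond_eq_iff n ξ k hk
    · have : k = n - 1 := by omega
      subst this
      have := hξ.2.2
      rw [show n - 1 + 2 = n + 1 by ring]
      simp [this, diamond_pred]
  rw [key] at hi
  unfold sl at *
  rw [show k + 1 + 1 = k + 2 by ring] at *
  rcases hd with hd | hd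
  · rw [hd] at hi ⊢
    simp only [zero_ne_one, false_iff] at hi
    omega
  · rw [hd] at hi ⊢
    simp only [true_iff] at hi
    omega

/-- normalized initial column -/
noncomputable def D0 (n : ℤ) (ξ : ℤ → ℤ) (k : ℤ) : V → ℤ
  | V.pr l => (if l = k then 1 else if l = k + 1 ∧ dd n ξ k = 0 then -1 else 0)
  | V.dpr l => (if l = k then 1 else if l = k + 1 ∧ dd n ξ k = 0 then -1 else 0)
  | V.mut l => if l = k - 1 ∧ 1 ≤ l then -1 else if l = k + 1 ∧ l ≤ n then
      (if dd n ξ k = 0 then 1 else -1) else 0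

lemma Bxi_col (n : ℤ) (hn : 2 ≤ n) (ξ : ℤ → ℤ) (hξ : HeightFunction n ξ) (k : ℤ) (h1 : 1 ≤ k)
    (h2 : k ≤ n) (u : V) : Bxi n ξ u (V.mut k) = sl ξ k * D0 n ξ k u := by
  have a := sl_pm n hn ξ hξ k h1 h2
  have hd := dd_01 n ξ k
  have hdn := dd_n n ξ hn
  have hb := hξ.2.2
  have hs : 2 ≤ k → sl ξ k = sl ξ (k - 1) * (1 - 2 * dd n ξ (k - 1)) := by
    intro h
    have := sl_succ n hn ξ hξ (k - 1) (by omega) (by omega)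
    rwa [sub_add_cancel] at this
  have a' : 2 ≤ k → (sl ξ (k - 1) = 1 ∨ sl ξ (k - 1) = -1) := fun h =>
    sl_pm n hn ξ hξ (k - 1) (by omega) (by omega)
  have hd' := dd_01 n ξ (k - 1)
  unfold Bxi
  unfold sl at *
  rw [sub_add_cancel] at *
  rcases u with l | l | l
  · simp only [arrows, D0]
    grind
  · simp only [arrows, D0]
    by_cases hl : l = k - 1
    · subst hl
      grind
    · by_cases hl' : l = k + 1
      · subst hl'
        grind
      · grind
  · simp only [arrows, D0]
    grind

lemma seedFrom_succ (n : ℤ) (ξ : ℤ → ℤ) (i : ℤ) (m : ℕ) :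
    seedFrom n ξ i (m + 1) = mutateSeed (V.mut (i + m)) (seedFrom n ξ i m) := by
  simp [seedFrom, List.range_succ]

lemma seedFrom_zero (n : ℤ) (ξ : ℤ → ℤ) (i : ℤ) :
    seedFrom n ξ i 0 = ⟨initZ n, Bxi n ξ⟩ := by
  simp [seedFrom]

noncomputable def PosE (n : ℤ) (ξ : ℤ → ℤ) (i k : ℤ) : Finset V :=
  (if k = i ∨ dd n ξ (k - 1) = 1 then {V.pr k, V.dpr k} else ∅) ∪
    (if i < k then {V.mut (k - 1)} else ∅)

noncomputable def PosS (n : ℤ) (ξ : ℤ → ℤ) (i k : ℤ) : Finset V :=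
  PosE n ξ i k ∪ (if dd n ξ k = 0 then {V.mut (k + 1)} else ∅)

noncomputable def NegE (n : ℤ) (ξ : ℤ → ℤ) (k : ℤ) : Finset V :=
  (if dd n ξ k = 0 then {V.pr (k + 1), V.dpr (k + 1)} else
    if k < n then {V.mut (k + 1)} else ∅)

noncomputable def Mset (n : ℤ) (ξ : ℤ → ℤ) (i : ℤ) : ℕ → Finset V
  | 0 => if 2 ≤ i then {V.mut (i - 1)} else ∅
  | m + 1 => if dd n ξ (i + m) = 0 then Mset n ξ i m else PosE n ξ i (i + m)

lemma Mset_bd (n : ℤ) (ξ : ℤ → ℤ) (i : ℤ) (m : ℕ) :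
    (∀ l, V.pr l ∈ Mset n ξ i m → l < i + m) ∧ (∀ l, V.dpr l ∈ Mset n ξ i m → l < i + m) ∧
    (∀ l, V.mut l ∈ Mset n ξ i m → l < i + m ∧ (m ≠ 0 → l < i + m - 1)) := by
  induction m with
  | zero =>
    simp only [Mset]
    split_ifs <;> simp
  | succ m ih =>
    obtain ⟨h1, h2, h3⟩ := ih
    simp only [Mset]
    split_ifs
    · refine ⟨fun l hl => ?_, fun l hl => ?_, fun l hl => ?_⟩
      · have := h1 l hl; push_cast; omega
      · have := h2 l hl; push_cast; omega
      · have := h3 l hl; push_cast; omega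
    · unfold PosE
      refine ⟨fun l hl => ?_, fun l hl => ?_, fun l hl => ?_⟩ <;>
      · push_cast
        split_ifs at hl <;> simp at hl <;> omega

/-- normalized column just before mutating at `k = i + m` -/
noncomputable def Dm (n : ℤ) (ξ : ℤ → ℤ) (i : ℤ) (m : ℕ) (u : V) : ℤ :=
  if u ∈ PosS n ξ i (i + m) then 1 else if u ∈ Mset n ξ i m ∪ NegE n ξ (i + m) then -1 else 0

lemma Dm_zero (n : ℤ) (hn : 2 ≤ n) (ξ : ℤ → ℤ) (i : ℤ) (h1 : 1 ≤ i) (h2 : i ≤ n) (u : V) :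
    D0 n ξ i u = Dm n ξ i 0 u := by
  have hd := dd_01 n ξ i
  have hdn := dd_n n ξ hn
  unfold Dm PosS PosE NegE Mset
  cases u <;> simp only [D0] <;> grind

lemma mutStep (s s' d x y : ℤ) (hs : s = 1 ∨ s = -1) (hd : d = 0 ∨ d = 1)
    (h : s' = s * (1 - 2 * d)) (hx : x = 0 ∨ x = 1 ∨ x = -1) :
    s' * y + (|s * x| * (s' * (-1)) + s * x * |s' * (-1)|) / 2 =
      s' * (y - (if d = 0 then (if x = -1 then 1 else 0) else if x = 1 then 1 else 0)) := by
  rcases hs with rfl | rfl <;> rcases hd with rfl | rfl <;> rcases hx with rfl | rfl | rfl <;>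
    subst h <;> norm_num <;> ring

lemma Dm_01 (n : ℤ) (ξ : ℤ → ℤ) (i : ℤ) (m : ℕ) (u : V) :
    Dm n ξ i m u = 0 ∨ Dm n ξ i m u = 1 ∨ Dm n ξ i m u = -1 := by
  unfold Dm; split_ifs <;> simp

lemma Dm_succ (n : ℤ) (hn : 2 ≤ n) (ξ : ℤ → ℤ) (i : ℤ) (m : ℕ) (h1 : 1 ≤ i) (h2 : i + m + 1 ≤ n)
    (u : V) (hu : u ≠ V.mut (i + m)) :
    D0 n ξ (i + m + 1) u - (if dd n ξ (i + m) = 0 then (if Dm n ξ i m u = -1 then 1 else 0)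
      else if Dm n ξ i m u = 1 then 1 else 0) = Dm n ξ i (m + 1) u := by
  have hd := dd_01 n ξ (i + m)
  have hd' := dd_01 n ξ (i + m + 1)
  have hdn := dd_n n ξ hn
  obtain ⟨b1, b2, b3⟩ := Mset_bd n ξ i m
  have e1 : i + (m : ℤ) + 1 - 1 = i + m := by ring
  unfold Dm
  simp only [Mset, PosS, NegE]
  push_cast
  rw [← add_assoc]
  unfold PosE
  rw [e1]
  rcases u with l | l | l
  · have := b1 l
    simp only [D0]
    grind
  · have := b3 l
    have hl : l ≠ i + m := fun h => hu (by rw [h])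
    simp only [D0]
    grind
  · have := b2 l
    simp only [D0]
    grind

lemma seed_cols (n : ℤ) (hn : 2 ≤ n) (ξ : ℤ → ℤ) (hξ : HeightFunction n ξ) (i : ℤ) (h1 : 1 ≤ i)
    (m : ℕ) : i + m ≤ n →
    (∀ u, (seedFrom n ξ i m).2 u (V.mut (i + m)) = sl ξ (i + m) * Dm n ξ i m u) ∧
    (∀ l, i + m < l → l ≤ n → ∀ u, (seedFrom n ξ i m).2 u (V.mut l) = Bxi n ξ u (V.mut l)) := by
  induction m with
  | zero =>
    intro h
    simp only [seedFrom_zero]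
    refine ⟨fun u => ?_, fun _ _ _ _ => by trivial⟩
    simp only [Nat.cast_zero, add_zero] at *
    rw [Bxi_col n hn ξ hξ i h1 h, Dm_zero n hn ξ i h1 h]
  | succ m ih =>
    intro h
    push_cast at *
    rw [← add_assoc] at *
    obtain ⟨ha, hb⟩ := ih (by omega)
    rw [seedFrom_succ]
    have hs := sl_succ n hn ξ hξ (i + m) (by omega) h
    have hs1 := sl_pm n hn ξ hξ (i + m) (by omega) (by omega)
    refine ⟨fun u => ?_, fun l hl hln u => ?_⟩
    · have hB : (seedFrom n ξ i m).2 (V.mut (i + m)) (V.mut (i + m + 1)) =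
          sl ξ (i + m + 1) * (-1) := by
        rw [hb _ (by omega) h, Bxi_col n hn ξ hξ _ (by omega) h]
        simp only [D0]
        rw [if_pos (by omega)]
      simp only [mutateSeed, mutateB]
      rw [if_neg (by simp [V.frozen])]
      by_cases hu : u = V.mut (i + m)
      · rw [if_pos (Or.inl hu), hu, hB]
        unfold Dm
        rw [if_pos]
        · ring
        · push_cast
          rw [← add_assoc]
          simp only [PosS, PosE]
          rw [show i + (m : ℤ) + 1 - 1 = i + m by ring]
          simp
      · rw [if_neg (by simp [hu]), hB, ha, hb _ (by omega) h, Bxi_col n hn ξ hξ _ (by omega) h,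
          mutStep _ _ _ _ _ hs1 (dd_01 n ξ (i + m)) hs (Dm_01 n ξ i m u),
          Dm_succ n hn ξ i m h1 h u hu]
    · have hB : (seedFrom n ξ i m).2 (V.mut (i + m)) (V.mut l) = 0 := by
        rw [hb _ (by omega) hln, Bxi_col n hn ξ hξ _ (by omega) hln]
        simp only [D0]
        rw [if_neg (by omega), if_neg (by omega), mul_zero]
      simp only [mutateSeed, mutateB]
      rw [if_neg (by simp [V.frozen])]
      by_cases hu : u = V.mut (i + m)
      · rw [if_pos (Or.inl hu), ← hb l (by omega) hln, hu, hB]; simp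
      · have : V.mut l ≠ V.mut (i + m) := by
          intro h'; injection h'; omega
        rw [if_neg (by simp only [hu, this, or_self, not_false_eq_true]), hB, hb l (by omega) hln]
        simp

lemma seed_vals (n : ℤ) (ξ : ℤ → ℤ) (i : ℤ) (m : ℕ) :
    (∀ l, (seedFrom n ξ i m).1 (V.pr l) = fp n l) ∧
    (∀ l, (seedFrom n ξ i m).1 (V.dpr l) = fpp n l) ∧
    (∀ l, l < i ∨ i + m ≤ l → (seedFrom n ξ i m).1 (V.mut l) = xv n l) ∧
    (∀ l, i ≤ l → l < i + m → (seedFrom n ξ i m).1 (V.mut l) = xAlpha n ξ i l) := by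
  induction m with
  | zero =>
    simp only [seedFrom_zero]
    refine ⟨fun _ => rfl, fun _ => rfl, fun _ _ => rfl, fun l h h' => ?_⟩
    push_cast at h'
    omega
  | succ m ih =>
    obtain ⟨h1, h2, h3, h4⟩ := ih
    refine ⟨fun l => ?_, fun l => ?_, fun l hl => ?_, fun l hl hl' => ?_⟩
    · rw [seedFrom_succ]; simp [mutateSeed, h1]
    · rw [seedFrom_succ]; simp [mutateSeed, h2]
    · push_cast at hl
      rw [seedFrom_succ]
      simp only [mutateSeed]
      rw [if_neg (by intro h'; injection h'; omega), h3 l (by omega)]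
    · push_cast at hl'
      by_cases hk : l = i + m
      · subst hk
        unfold xAlpha
        rw [show (i + (m : ℤ) + 1 - i).toNat = m + 1 by omega]
      · rw [seedFrom_succ]
        simp only [mutateSeed]
        rw [if_neg (by intro h'; injection h'; omega), h4 l hl (by omega)]

lemma finprod_ind (z : V → F) (P : Finset V) (c : V → ℕ)
    (hc : ∀ u, c u = if u ∈ P then 1 else 0) : (finprod fun u => z u ^ c u) = ∏ u ∈ P, z u := by
  rw [finprod_eq_prod_of_mulSupport_subset (s := P)]
  · apply Finset.prod_congr rfl
    intro u hu
    rw [hc, if_pos hu, pow_one]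
  · intro u hu
    by_contra h
    apply hu
    have : u ∉ P := h
    simp [hc, this]

lemma pos_neg_disj (n : ℤ) (ξ : ℤ → ℤ) (i : ℤ) (m : ℕ) :
    Disjoint (PosS n ξ i (i + m)) (Mset n ξ i m ∪ NegE n ξ (i + m)) := by
  obtain ⟨b1, b2, b3⟩ := Mset_bd n ξ i m
  rw [Finset.disjoint_left]
  intro u hu hu'
  rcases u with l | l | l
  · have := b1 l
    unfold PosS PosE NegE at *
    grind
  · have := b3 l
    unfold PosS PosE NegE at *
    grind
  · have := b2 l
    unfold PosS PosE NegE at *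
    grind

lemma M_neg_disj (n : ℤ) (ξ : ℤ → ℤ) (i : ℤ) (m : ℕ) :
    Disjoint (Mset n ξ i m) (NegE n ξ (i + m)) := by
  obtain ⟨b1, b2, b3⟩ := Mset_bd n ξ i m
  rw [Finset.disjoint_left]
  intro u hu hu'
  rcases u with l | l | l
  · have := b1 l
    unfold NegE at *
    grind
  · have := b3 l
    unfold NegE at *
    grind
  · have := b2 l
    unfold NegE at *
    grind

lemma xv_ne (n l : ℤ) : xv n l ≠ 0 := by
  unfold xv initZ gen
  simp only
  split_ifs
  · rw [Ne, FaithfulSMul.algebraMap_eq_zero_iff]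
    exact MvPolynomial.X_ne_zero _
  · exact one_ne_zero

lemma xv_out (n l : ℤ) (h : l < 1 ∨ n < l) : xv n l = 1 := by
  unfold xv initZ
  simp only
  rw [if_neg (by omega)]

noncomputable def PE (n : ℤ) (ξ : ℤ → ℤ) (i k : ℤ) : F :=
  (if k = i ∨ dd n ξ (k - 1) = 1 then fp n k * fpp n k else 1) *
    (if i < k then xAlpha n ξ i (k - 1) else 1)

noncomputable def Mp (n : ℤ) (ξ : ℤ → ℤ) (i : ℤ) : ℕ → F
  | 0 => xv n (i - 1)
  | m + 1 => if dd n ξ (i + m) = 0 then Mp n ξ i m else PE n ξ i (i + m)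

lemma prod_PosE (n : ℤ) (ξ : ℤ → ℤ) (i : ℤ) (m m' : ℕ) (h : m ≤ m') :
    ∏ u ∈ PosE n ξ i (i + m), (seedFrom n ξ i m').1 u = PE n ξ i (i + m) := by
  obtain ⟨v1, v2, v3, v4⟩ := seed_vals n ξ i m'
  unfold PosE PE
  rw [Finset.prod_union]
  · congr 1
    · split_ifs
      · rw [Finset.prod_pair (by simp), v1, v2]
      · simp
    · split_ifs
      · rw [Finset.prod_singleton, v4 _ (by omega) (by omega)]
      · simp
  · split_ifs <;> simp

lemma prod_M (n : ℤ) (ξ : ℤ → ℤ) (i : ℤ) (h1 : 1 ≤ i) (m : ℕ) : ∀ m', m ≤ m' →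
    ∏ u ∈ Mset n ξ i m, (seedFrom n ξ i m').1 u = Mp n ξ i m := by
  induction m with
  | zero =>
    intro m' _
    obtain ⟨v1, v2, v3, v4⟩ := seed_vals n ξ i m'
    unfold Mset Mp
    split_ifs
    · rw [Finset.prod_singleton, v3 _ (by omega)]
    · rw [xv_out _ _ (by omega)]; simp
  | succ m ih =>
    intro m' h
    unfold Mset Mp
    split_ifs
    · exact ih m' (by omega)
    · exact prod_PosE n ξ i m m' (by omega)

lemma exchange (n : ℤ) (hn : 2 ≤ n) (ξ : ℤ → ℤ) (hξ : HeightFunction n ξ) (i : ℤ) (h1 : 1 ≤ i)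
    (m : ℕ) (h : i + m ≤ n) (hd : dd n ξ (i + m) = 1) :
    xAlpha n ξ i (i + m) * xv n (i + m) =
      PE n ξ i (i + m) + Mp n ξ i m * xv n (i + m + 1) := by
  obtain ⟨v1, v2, v3, v4⟩ := seed_vals n ξ i m
  have hc := (seed_cols n hn ξ hξ i h1 m h).1
  have hs := sl_pm n hn ξ hξ (i + m) (by omega) h
  have hdis := pos_neg_disj n ξ i m
  have hP : ∏ u ∈ PosS n ξ i (i + m), (seedFrom n ξ i m).1 u = PE n ξ i (i + m) := by
    unfold PosS
    rw [if_neg (by omega), Finset.union_empty, prod_PosE n ξ i m m le_rfl]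
  have hN : ∏ u ∈ Mset n ξ i m ∪ NegE n ξ (i + m), (seedFrom n ξ i m).1 u =
      Mp n ξ i m * xv n (i + m + 1) := by
    rw [Finset.prod_union (M_neg_disj n ξ i m), prod_M n ξ i h1 m m le_rfl]
    congr 1
    unfold NegE
    rw [if_neg (by omega)]
    split_ifs
    · rw [Finset.prod_singleton, v3 _ (by omega)]
    · rw [xv_out _ _ (by omega)]; simp
  have hx : xAlpha n ξ i (i + m) = (seedFrom n ξ i (m + 1)).1 (V.mut (i + m)) := by
    unfold xAlpha
    rw [show (i + (m : ℤ) + 1 - i).toNat = m + 1 by omega]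
  rw [hx, seedFrom_succ]
  simp only [mutateSeed, if_true]
  rw [v3 (i + m) (by omega), div_mul_cancel₀ _ (xv_ne _ _), ← hP, ← hN]
  have hdis' : ∀ u, u ∈ PosS n ξ i (i + m) → u ∉ Mset n ξ i m ∪ NegE n ξ (i + m) :=
    fun u hu => Finset.disjoint_left.1 hdis hu
  rcases hs with hs | hs
  · congr 1
    · apply finprod_ind
      intro u
      rw [hc, hs, Dm]
      have := hdis' u
      split_ifs <;> simp
    · apply finprod_ind
      intro u
      rw [hc, hs, Dm]
      have := hdis' u
      split_ifs <;> simp_all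
  · rw [add_comm]
    congr 1
    · apply finprod_ind
      intro u
      rw [hc, hs, Dm]
      have := hdis' u
      split_ifs <;> simp
    · apply finprod_ind
      intro u
      rw [hc, hs, Dm]
      have := hdis' u
      split_ifs <;> simp_all

lemma Mp_eq_init (n : ℤ) (ξ : ℤ → ℤ) (i : ℤ) (m : ℕ)
    (h : ∀ l, i ≤ l → l < i + m → dd n ξ l = 0) : Mp n ξ i m = xv n (i - 1) := by
  induction m with
  | zero => rfl
  | succ m ih =>
    unfold Mp
    push_cast at h
    rw [if_pos (h _ (by omega) (by omega))]
    exact ih fun l h1 h2 => h l h1 (by omega)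

lemma Mp_eq_PE (n : ℤ) (ξ : ℤ → ℤ) (i : ℤ) (m : ℕ) (b : ℤ) (hb : i ≤ b) (hb' : b < i + m)
    (hd : dd n ξ b = 1) (h : ∀ l, b < l → l < i + m → dd n ξ l = 0) :
    Mp n ξ i m = PE n ξ i b := by
  induction m with
  | zero => push_cast at hb'; omega
  | succ m ih =>
    unfold Mp
    push_cast at h hb'
    by_cases hk : b = i + m
    · subst hk
      rw [if_neg (by omega)]
    · rw [if_pos (h _ (by omega) (by omega))]
      exact ih (by omega) fun l h1 h2 => h l h1 (by omega)

lemma core (n : ℤ) (hn : 2 ≤ n) (ξ : ℤ → ℤ) (hξ : HeightFunction n ξ) (i : ℤ) (h1 : 1 ≤ i)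
    (m : ℕ) (hj : i + m + 1 ≤ n) (hd : dd n ξ (i + m) = 1) (hd1 : dd n ξ (i + m + 1) = 1) :
    xAlpha n ξ i (i + m + 1) = xAlpha n ξ i (i + m) * xAlpha n ξ (i + m + 1) (i + m + 1) -
      Mp n ξ i m * xv n (i + m + 2) := by
  have e1 := exchange n hn ξ hξ i h1 m (by omega) hd
  have e2 := exchange n hn ξ hξ i h1 (m + 1) (by push_cast; omega)
    (by push_cast; rw [← add_assoc]; exact hd1)
  have e3 := exchange n hn ξ hξ (i + m + 1) (by omega) 0 (by simpa using hj) (by simpa using hd1)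
  simp only [Mp] at e2 e3
  push_cast at e2 e3
  rw [if_neg (by omega)] at e2
  rw [add_zero] at e3
  rw [← add_assoc] at e2
  have p2 : PE n ξ i (i + m + 1) = fp n (i + m + 1) * fpp n (i + m + 1) * xAlpha n ξ i (i + m) := by
    unfold PE
    rw [add_sub_cancel_right, if_pos (Or.inr hd), if_pos (by omega)]
  have p3 : PE n ξ (i + m + 1) (i + m + 1) = fp n (i + m + 1) * fpp n (i + m + 1) := by
    unfold PE
    rw [if_pos (Or.inl rfl), if_neg (by omega), mul_one]
  rw [p2] at e2
  rw [p3, add_sub_cancel_right] at e3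
  rw [show i + (m : ℤ) + 1 + 1 = i + m + 2 by ring] at e2 e3
  apply mul_right_cancel₀ (xv_ne n (i + m + 1))
  linear_combination e2 - xAlpha n ξ i (i + m) * e3 - xv n (i + m + 2) * e1

lemma bullet_pos (n : ℤ) (ξ : ℤ → ℤ) (k l : ℤ) (hl1 : 1 ≤ l) (hl : l < k) (hk : k ≤ n)
    (hd : dd n ξ l = 1) : l ≤ bullet n ξ k := by
  rw [dd_one_iff n ξ l hl1] at hd
  have h := diamond_le n ξ 1 l hl1 (by omega) hd
  unfold bullet
  rw [if_neg (by omega)]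
  exact le_csSup ⟨k, fun x hx => hx.2.1.le⟩ ⟨h, hl, hd.symm⟩

lemma bullet_spec (n : ℤ) (hn : 2 ≤ n) (ξ : ℤ → ℤ) (k : ℤ) (hk : k ≤ n) :
    bullet n ξ k = 0 ∨ (1 ≤ bullet n ξ k ∧ bullet n ξ k < k ∧ dd n ξ (bullet n ξ k) = 1) := by
  by_cases h : k ≤ diamond n ξ 1
  · left; unfold bullet; rw [if_pos h]
  right
  have hone := le_diamond n ξ 1 (by omega)
  have hfix : diamond n ξ (diamond n ξ 1) = diamond n ξ 1 := by
    have hdef : diamond n ξ 1 = if ({l : ℤ | 1 ≤ l ∧ l ≤ n - 2 ∧ ξ l = ξ (l + 2)} : Set ℤ).Nonempty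
      then sInf {l : ℤ | 1 ≤ l ∧ l ≤ n - 2 ∧ ξ l = ξ (l + 2)} else n - 1 := by
      conv_lhs => unfold diamond
      rw [if_neg (by omega)]
    split_ifs at hdef with hne
    · have := Int.csInf_mem hne ⟨1, fun l hl => hl.1⟩
      rw [← hdef] at this
      exact (diamond_eq_iff n ξ _ this.2.1).2 this.2.2
    · rw [hdef, diamond_pred]
  have hmem : sSup {l : ℤ | diamond n ξ 1 ≤ l ∧ l < k ∧ l = diamond n ξ l} ∈
      {l : ℤ | diamond n ξ 1 ≤ l ∧ l < k ∧ l = diamond n ξ l} :=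
    Int.csSup_mem ⟨diamond n ξ 1, le_rfl, by omega, hfix.symm⟩ ⟨k, fun x hx => hx.2.1.le⟩
  have hb : bullet n ξ k = sSup {l : ℤ | diamond n ξ 1 ≤ l ∧ l < k ∧ l = diamond n ξ l} := by
    unfold bullet; rw [if_neg h]
  rw [← hb] at hmem
  obtain ⟨m1, m2, m3⟩ := hmem
  have : 1 ≤ bullet n ξ k := by omega
  exact ⟨this, m2, (dd_one_iff n ξ _ this).2 m3.symm⟩

/-- Let `1 ≤ i < j+1 ≤ n` with `j_⋄ = j` and `(j+1)_⋄ = j+1`. Then the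
four exchange identities of Proposition 4.9 hold:
(1) if `j_• = i_•`: `x[α_{i,j+1}] = x[α_{i,j}] x[α_{j+1,j+1}] − x_{i−1} x_{j+2}`;
(2) if `j_• = i`: `x[α_{i,j+1}] = x[α_{i,j}] x[α_{j+1,j+1}] − f′_i f″_i x_{j+2}`;
(3) if `j_• > i` and `j_•−1 = (j_•−1)_⋄`:
`x[α_{i,j+1}] = x[α_{i,j}] x[α_{j+1,j+1}] − x[α_{i,j_•−1}] f′_{j_•} f″_{j_•} x_{j+2}`;
(4) if `j_• > i` and `j_•−1 ≠ (j_•−1)_⋄`: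
`x[α_{i,j+1}] = x[α_{i,j}] x[α_{j+1,j+1}] − x[α_{i,j_•−1}] x_{j+2}`. -/
theorem recursive_exchange_identities (n : ℤ) (hn : 2 ≤ n) (ξ : ℤ → ℤ)
    (hξ : HeightFunction n ξ) (i j : ℤ) (h1 : 1 ≤ i) (hij : i < j + 1) (hj : j + 1 ≤ n)
    (hdj : diamond n ξ j = j) (hdj1 : diamond n ξ (j + 1) = j + 1) :
    (bullet n ξ j = bullet n ξ i →
      xAlpha n ξ i (j + 1) =
        xAlpha n ξ i j * xAlpha n ξ (j + 1) (j + 1) - xv n (i - 1) * xv n (j + 2)) ∧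
    (bullet n ξ j = i →
      xAlpha n ξ i (j + 1) =
        xAlpha n ξ i j * xAlpha n ξ (j + 1) (j + 1) - fp n i * fpp n i * xv n (j + 2)) ∧
    (i < bullet n ξ j → diamond n ξ (bullet n ξ j - 1) = bullet n ξ j - 1 →
      xAlpha n ξ i (j + 1) =
        xAlpha n ξ i j * xAlpha n ξ (j + 1) (j + 1) -
          xAlpha n ξ i (bullet n ξ j - 1) * fp n (bullet n ξ j) * fpp n (bullet n ξ j) *
            xv n (j + 2)) ∧
    (i < bullet n ξ j → diamond n ξ (bullet n ξ j - 1) ≠ bullet n ξ j - 1 →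
      xAlpha n ξ i (j + 1) =
        xAlpha n ξ i j * xAlpha n ξ (j + 1) (j + 1) -
          xAlpha n ξ i (bullet n ξ j - 1) * xv n (j + 2)) := by
  obtain ⟨m, hm⟩ : ∃ m : ℕ, j = i + m := ⟨(j - i).toNat, by omega⟩
  have hd : dd n ξ j = 1 := (dd_one_iff n ξ j (by omega)).2 hdj
  have hd1 : dd n ξ (j + 1) = 1 := (dd_one_iff n ξ (j + 1) (by omega)).2 hdj1
  have hcore := core n hn ξ hξ i h1 m (by omega) (by rw [← hm]; exact hd) (by rw [← hm]; exact hd1)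
  rw [← hm] at hcore
  have hsp := bullet_spec n hn ξ j (by omega)
  have hz : ∀ l, 1 ≤ l → bullet n ξ j < l → l < j → dd n ξ l = 0 := by
    intro l hl hbl hlj
    rcases dd_01 n ξ l with h | h
    · exact h
    · have := bullet_pos n ξ j l hl hlj (by omega) h
      omega
  have hPE : i ≤ bullet n ξ j → Mp n ξ i m = PE n ξ i (bullet n ξ j) := by
    intro hb
    have hsp' := hsp.resolve_left (by omega)
    exact Mp_eq_PE n ξ i m _ hb (by omega) hsp'.2.2 fun l hl hl' => hz l (by omega) hl (by omega)
  refine ⟨fun hb => ?_, fun hb => ?_, fun hb hbd => ?_, fun hb hbd => ?_⟩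
  · have hi := bullet_spec n hn ξ i (by omega)
    rw [hcore, Mp_eq_init]
    intro l hl hl'
    exact hz l (by omega) (by omega) (by omega)
  · rw [hcore, hPE (by omega), hb]
    unfold PE
    rw [if_pos (Or.inl rfl), if_neg (by omega), mul_one]
  · rw [hcore, hPE (by omega)]
    unfold PE
    rw [if_pos (Or.inr ((dd_one_iff n ξ _ (by omega)).2 hbd)), if_pos hb]
    ring
  · rw [hcore, hPE (by omega)]
    unfold PE
    rw [if_neg, if_pos hb]
    · ring
    · rintro (h | h)
      · omega
      · exact hbd ((dd_one_iff n ξ _ (by omega)).1 h)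
end
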